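/- A variety V has a difference term if and only if V has a weak difference term and, whenever the pentagon N5 is a sublattice of Con(A) for some A ∈ V, the critical interval of that pentagon is neutral. -/

import Mathlib

/-- A (universal-algebraic) signature: a type of operation symbols with arities. -/
structure Sig where
  ops : Type
  arity : ops → ℕ

/-- An algebra for a signature: a carrier set with an interpretation of each
operation symbol. -/
structure Alg (σ : Sig) where
  carrier : Type
  interp : ∀ f : σ.ops, (Fin (σ.arity f) → carrier) → carrier

/-- Terms over a signature with variables from `V`. -/
inductive Trm (σ : Sig) (V : Type) : Type
  | var : V → Trm σ V
  | op : (f : σ.ops) → (Fin (σ.arity f) → Trm σ V) → Trm σ V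

/-- Evaluation of a term in an algebra under an assignment of the variables. -/
def Alg.evalTrm {σ : Sig} (A : Alg σ) {V : Type} (asg : V → A.carrier) :
    Trm σ V → A.carrier
  | .var v => asg v
  | .op f ts => A.interp f fun i => A.evalTrm asg (ts i)

/-- A congruence on an algebra: an equivalence relation compatible with the
basic operations. -/
structure Congruence {σ : Sig} (A : Alg σ) where
  rel : A.carrier → A.carrier → Prop
  iseqv : Equivalence rel
  compat : ∀ (f : σ.ops) (a b : Fin (σ.arity f) → A.carrier),
    (∀ i, rel (a i) (b i)) → rel (A.interp f a) (A.interp f b)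

namespace Congruence

variable {σ : Sig} {A : Alg σ}

theorem ext' {c d : Congruence A} (h : c.rel = d.rel) : c = d := by
  cases c; cases d; cases h; rfl

instance : PartialOrder (Congruence A) where
  le c d := ∀ a b, c.rel a b → d.rel a b
  le_refl c a b h := h
  le_trans c d e h1 h2 a b h := h2 a b (h1 a b h)
  le_antisymm c d h1 h2 :=
    ext' (funext fun a => funext fun b => propext ⟨h1 a b, h2 a b⟩)

instance : InfSet (Congruence A) where
  sInf S :=
    { rel := fun a b => ∀ c ∈ S, c.rel a b
      iseqv := ⟨fun a c _ => c.iseqv.refl a,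
                fun h c hc => c.iseqv.symm (h c hc),
                fun h1 h2 c hc => c.iseqv.trans (h1 c hc) (h2 c hc)⟩
      compat := fun f a b h c hc => c.compat f a b fun i => h i c hc }

/-- The congruences of an algebra form a complete lattice (`⊥` is the equality
congruence, `⊤` is the total congruence, meet is intersection). -/
instance : CompleteLattice (Congruence A) :=
  completeLatticeOfInf _ fun S =>
    ⟨fun c hc a b h => h c hc, fun c hc a b h d hd => hc hd a b h⟩

end Congruence

/-- `Centralizes S T δ` is the centralizer relation `C(S,T;δ)`: for every
`S,T`-matrix `[[p,q],[r,s]]` (built from a term operation `t`, tuples `a S b`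
and `u T v`), if `(p,q) ∈ δ` then `(r,s) ∈ δ`. -/
def Centralizes {σ : Sig} {A : Alg σ} (S T δ : Congruence A) : Prop :=
  ∀ (m n : ℕ) (t : Trm σ (Sum (Fin m) (Fin n)))
    (a b : Fin m → A.carrier) (u v : Fin n → A.carrier),
    (∀ i, S.rel (a i) (b i)) → (∀ j, T.rel (u j) (v j)) →
    δ.rel (A.evalTrm (Sum.elim a u) t) (A.evalTrm (Sum.elim a v) t) →
    δ.rel (A.evalTrm (Sum.elim b u) t) (A.evalTrm (Sum.elim b v) t)

/-- The commC `[S,T]`: the least congruence `δ` with `C(S,T;δ)`. -/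
def commC {σ : Sig} {A : Alg σ} (S T : Congruence A) : Congruence A :=
  sInf {δ | Centralizes S T δ}

/-- The relative commC `[S,T]_ε`: the intersection of all congruences
`γ ≥ ε` with `C(S,T;γ)`. -/
def relCommC {σ : Sig} {A : Alg σ} (S T ε : Congruence A) : Congruence A :=
  sInf {γ | ε ≤ γ ∧ Centralizes S T γ}

/-- The congruence generated by a single pair `(x, y)`. -/
def cgPair {σ : Sig} (A : Alg σ) (x y : A.carrier) : Congruence A :=
  sInf {c | c.rel x y}

/-- Homomorphisms of algebras. -/
structure UAHom {σ : Sig} (A B : Alg σ) where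
  toFun : A.carrier → B.carrier
  map_op : ∀ (f : σ.ops) (a : Fin (σ.arity f) → A.carrier),
    toFun (A.interp f a) = B.interp f (fun i => toFun (a i))

/-- The product of a family of algebras. -/
def prodAlg {σ : Sig} {I : Type} (F : I → Alg σ) : Alg σ where
  carrier := ∀ i, (F i).carrier
  interp f a := fun i => (F i).interp f (fun j => a j i)

/-- A variety: a class of algebras of a fixed signature closed under
homomorphic images, subalgebras (here: isomorphic copies of subalgebras,
i.e. sources of injective homomorphisms), and arbitrary products. -/
structure Variety (σ : Sig) where
  Mem : Alg σ → Prop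
  closed_hom : ∀ {A B : Alg σ}, Mem A →
    (∃ h : UAHom A B, Function.Surjective h.toFun) → Mem B
  closed_sub : ∀ {A B : Alg σ}, Mem A →
    (∃ h : UAHom B A, Function.Injective h.toFun) → Mem B
  closed_prod : ∀ {I : Type} (F : I → Alg σ), (∀ i, Mem (F i)) → Mem (prodAlg F)

/-- The setoid associated with a congruence. -/
def Congruence.setoid {σ : Sig} {A : Alg σ} (c : Congruence A) :
    Setoid A.carrier := ⟨c.rel, c.iseqv⟩

/-- The quotient algebra of an algebra by a congruence. -/
noncomputable def quotAlg {σ : Sig} (A : Alg σ) (c : Congruence A) : Alg σ where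
  carrier := Quotient c.setoid
  interp f a := Quotient.mk c.setoid (A.interp f fun i => (a i).out)

/-- `algOn A α` is the algebra `A(α)`: the subalgebra of `A × A` whose
universe is `α`. -/
def algOn {σ : Sig} (A : Alg σ) (α : Congruence A) : Alg σ where
  carrier := {p : A.carrier × A.carrier // α.rel p.1 p.2}
  interp f a := ⟨(A.interp f fun i => (a i).1.1, A.interp f fun i => (a i).1.2),
    α.compat f _ _ fun i => (a i).2⟩

/-- The kernel of the first coordinate projection of `A(α)`. -/
def eta1 {σ : Sig} (A : Alg σ) (α : Congruence A) : Congruence (algOn A α) where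
  rel p q := p.1.1 = q.1.1
  iseqv := ⟨fun _ => rfl, Eq.symm, Eq.trans⟩
  compat f a b h := congrArg (A.interp f) (funext h)

/-- The kernel of the second coordinate projection of `A(α)`. -/
def eta2 {σ : Sig} (A : Alg σ) (α : Congruence A) : Congruence (algOn A α) where
  rel p q := p.1.2 = q.1.2
  iseqv := ⟨fun _ => rfl, Eq.symm, Eq.trans⟩
  compat f a b h := congrArg (A.interp f) (funext h)

/-- The congruence `Δ_{α,β}` on `A(α)` generated by the `β`-diagonal pairs. -/
def diagDelta {σ : Sig} (A : Alg σ) (α β : Congruence A) :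
    Congruence (algOn A α) :=
  sInf {c | ∀ x z : A.carrier, β.rel x z →
    c.rel ⟨(x, x), α.iseqv.refl x⟩ ⟨(z, z), α.iseqv.refl z⟩}

/-- A pentagon (five-element sublattice isomorphic to `N₅`) in the congruence
lattice with bottom `z`, side element `β`, critical chain `δ < θ`, and top `α`. -/
def IsPentagon {σ : Sig} {A : Alg σ} (z β δ θ α : Congruence A) : Prop :=
  δ < θ ∧ β ⊓ θ = z ∧ β ⊓ δ = z ∧ β ⊔ δ = α ∧ β ⊔ θ = α

/-- Two congruences permute: `c ∘ d = d ∘ c`. -/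
def Permutes {σ : Sig} {A : Alg σ} (c d : Congruence A) : Prop :=
  ∀ a b : A.carrier, (∃ x, c.rel a x ∧ d.rel x b) ↔ (∃ x, d.rel a x ∧ c.rel x b)

/-- `T` is a Taylor term for the variety `V`: an idempotent term satisfying an
`i`-th place Taylor identity for every place `i`. -/
def IsTaylorTrm {σ : Sig} (V : Variety σ) {n : ℕ} (T : Trm σ (Fin n)) : Prop :=
  0 < n ∧
  (∀ A : Alg σ, V.Mem A → ∀ c : A.carrier, A.evalTrm (fun _ => c) T = c) ∧
  (∀ i : Fin n, ∃ w z : Fin n → Bool, w i ≠ z i ∧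
    ∀ A : Alg σ, V.Mem A → ∀ x y : A.carrier,
      A.evalTrm (fun j => cond (w j) x y) T = A.evalTrm (fun j => cond (z j) x y) T)

/-- `V` has a Taylor term. -/
def HasTaylorTrm {σ : Sig} (V : Variety σ) : Prop :=
  ∃ (n : ℕ) (T : Trm σ (Fin n)), IsTaylorTrm V T

/-- A congruence is abelian if `[α,α] = 0`. -/
def IsAbelianCong {σ : Sig} {A : Alg σ} (α : Congruence A) : Prop :=
  commC α α = ⊥

/-- `d` is a weak difference term for `V`: `d(a,a,b) = b` and `d(a,b,b) = a`
whenever the pair `(a,b)` lies in an abelian congruence of a member of `V`. -/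
def IsWeakDifferenceTrm {σ : Sig} (V : Variety σ) (d : Trm σ (Fin 3)) : Prop :=
  ∀ A : Alg σ, V.Mem A → ∀ α : Congruence A, IsAbelianCong α →
    ∀ a b : A.carrier, α.rel a b →
      A.evalTrm ![a, a, b] d = b ∧ A.evalTrm ![a, b, b] d = a

/-- `d` is a difference term for `V`: `V ⊨ d(x,x,y) ≈ y` and `d(a,b,b) = a`
whenever the pair `(a,b)` lies in an abelian congruence of a member of `V`. -/
def IsDifferenceTrm {σ : Sig} (V : Variety σ) (d : Trm σ (Fin 3)) : Prop :=
  (∀ A : Alg σ, V.Mem A → ∀ a b : A.carrier, A.evalTrm ![a, a, b] d = b) ∧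
  (∀ A : Alg σ, V.Mem A → ∀ α : Congruence A, IsAbelianCong α →
    ∀ a b : A.carrier, α.rel a b → A.evalTrm ![a, b, b] d = a)

/-- The commC is left distributive throughout `V`. -/
def CommLeftDistrib {σ : Sig} (V : Variety σ) : Prop :=
  ∀ A : Alg σ, V.Mem A → ∀ x y z : Congruence A,
    commC (x ⊔ y) z = commC x z ⊔ commC y z

/-- The commC is right distributive throughout `V`. -/
def CommRightDistrib {σ : Sig} (V : Variety σ) : Prop :=
  ∀ A : Alg σ, V.Mem A → ∀ x y z : Congruence A,
    commC x (y ⊔ z) = commC x y ⊔ commC x z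

/-- The commC is commutative throughout `V`. -/
def CommutativeCommutator {σ : Sig} (V : Variety σ) : Prop :=
  ∀ A : Alg σ, V.Mem A → ∀ x y : Congruence A, commC x y = commC y x

/-- `V` is congruence modular. -/
def CongruenceModular {σ : Sig} (V : Variety σ) : Prop :=
  ∀ A : Alg σ, V.Mem A → IsModularLattice (Congruence A)


section Helpers

variable {σ : Sig}

theorem bot_rel {A : Alg σ} {a b : A.carrier} (h : (⊥ : Congruence A).rel a b) : a = b := by
  let E : Congruence A :=
    { rel := fun a b => a = b
      iseqv := ⟨fun _ => rfl, Eq.symm, Eq.trans⟩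
      compat := fun f a b h => congrArg (A.interp f) (funext h) }
  exact (bot_le : (⊥ : Congruence A) ≤ E) a b h

theorem eval_compat {A : Alg σ} (c : Congruence A) {W : Type} (t : Trm σ W)
    (a b : W → A.carrier) (h : ∀ w, c.rel (a w) (b w)) :
    c.rel (A.evalTrm a t) (A.evalTrm b t) := by
  induction t with
  | var v => exact h v
  | op f ts ih => exact c.compat f _ _ ih

/-- Substitution of terms for variables. -/
def Trm.subst {V W : Type} (g : V → Trm σ W) : Trm σ V → Trm σ W
  | .var v => g v
  | .op f ts => .op f fun i => (ts i).subst g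

theorem eval_subst {A : Alg σ} {V W : Type} (g : V → Trm σ W) (a : W → A.carrier)
    (t : Trm σ V) :
    A.evalTrm a (t.subst g) = A.evalTrm (fun v => A.evalTrm a (g v)) t := by
  induction t with
  | var v => rfl
  | op f ts ih =>
    simp only [Trm.subst, Alg.evalTrm]
    congr 1
    funext i
    exact ih i

theorem eval_hom {A B : Alg σ} (h : UAHom A B) {V : Type} (a : V → A.carrier)
    (t : Trm σ V) :
    h.toFun (A.evalTrm a t) = B.evalTrm (fun v => h.toFun (a v)) t := by
  induction t with
  | var v => rfl
  | op f ts ih =>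
    simp only [Alg.evalTrm]
    rw [h.map_op]
    congr 1
    funext i
    exact ih i

/-- Pullback of a congruence along a homomorphism. -/
def comapC {A B : Alg σ} (h : UAHom A B) (c : Congruence B) : Congruence A where
  rel x y := c.rel (h.toFun x) (h.toFun y)
  iseqv := ⟨fun _ => c.iseqv.refl _, fun h => c.iseqv.symm h, fun h k => c.iseqv.trans h k⟩
  compat f a b hab := by
    rw [h.map_op, h.map_op]
    exact c.compat f _ _ hab

/-- The `S,T`-matrices, generated inductively. -/
inductive Mat {A : Alg σ} (S T : Congruence A) :
    A.carrier → A.carrier → A.carrier → A.carrier → Prop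
  | row (a b : A.carrier) : S.rel a b → Mat S T a a b b
  | col (u v : A.carrier) : T.rel u v → Mat S T u v u v
  | op (f : σ.ops) (p q r s : Fin (σ.arity f) → A.carrier) :
      (∀ i, Mat S T (p i) (q i) (r i) (s i)) →
      Mat S T (A.interp f p) (A.interp f q) (A.interp f r) (A.interp f s)

theorem Mat.term {A : Alg σ} {S T : Congruence A} {W : Type} (t : Trm σ W)
    (p q r s : W → A.carrier) (h : ∀ w, Mat S T (p w) (q w) (r w) (s w)) :
    Mat S T (A.evalTrm p t) (A.evalTrm q t) (A.evalTrm r t) (A.evalTrm s t) := by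
  induction t with
  | var v => exact h v
  | op f ts ih => exact Mat.op f _ _ _ _ ih

theorem Mat.swap {A : Alg σ} {S T : Congruence A} {p q r s : A.carrier}
    (h : Mat S T p q r s) : Mat S T r s p q := by
  induction h with
  | row a b h => exact Mat.row _ _ (S.iseqv.symm h)
  | col u v h => exact Mat.col _ _ h
  | op f p q r s _ ih => exact Mat.op f _ _ _ _ ih

theorem Mat.cols {A : Alg σ} {S T : Congruence A} {p q r s : A.carrier}
    (h : Mat S T p q r s) : T.rel p q ∧ T.rel r s := by
  induction h with
  | row a b h => exact ⟨T.iseqv.refl _, T.iseqv.refl _⟩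
  | col u v h => exact ⟨h, h⟩
  | op f p q r s _ ih =>
    exact ⟨T.compat f _ _ fun i => (ih i).1, T.compat f _ _ fun i => (ih i).2⟩

theorem Mat.rows {A : Alg σ} {S T : Congruence A} {p q r s : A.carrier}
    (h : Mat S T p q r s) : S.rel p r ∧ S.rel q s := by
  induction h with
  | row a b h => exact ⟨h, h⟩
  | col u v h => exact ⟨S.iseqv.refl _, S.iseqv.refl _⟩
  | op f p q r s _ ih =>
    exact ⟨S.compat f _ _ fun i => (ih i).1, S.compat f _ _ fun i => (ih i).2⟩

theorem Mat.mono {A : Alg σ} {S T S' T' : Congruence A} (hS : S ≤ S') (hT : T ≤ T')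
    {p q r s : A.carrier} (h : Mat S T p q r s) : Mat S' T' p q r s := by
  induction h with
  | row a b h => exact Mat.row _ _ (hS _ _ h)
  | col u v h => exact Mat.col _ _ (hT _ _ h)
  | op f p q r s _ ih => exact Mat.op f _ _ _ _ ih

theorem centralizes_of_mat {A : Alg σ} {S T δ : Congruence A}
    (h : ∀ p q r s, Mat S T p q r s → δ.rel p q → δ.rel r s) : Centralizes S T δ := by
  intro m n t a b u v hab huv
  apply h
  apply Mat.term
  rintro (i | j)
  · exact Mat.row _ _ (hab i)
  · exact Mat.col _ _ (huv j)

theorem Mat.exists_term {A : Alg σ} {S T : Congruence A} {p q r s : A.carrier}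
    (h : Mat S T p q r s) :
    ∃ (X Y : Type) (_ : Finite X) (_ : Finite Y) (t : Trm σ (X ⊕ Y))
      (a b : X → A.carrier) (u v : Y → A.carrier),
      (∀ i, S.rel (a i) (b i)) ∧ (∀ j, T.rel (u j) (v j)) ∧
      A.evalTrm (Sum.elim a u) t = p ∧ A.evalTrm (Sum.elim a v) t = q ∧
      A.evalTrm (Sum.elim b u) t = r ∧ A.evalTrm (Sum.elim b v) t = s := by
  induction h with
  | row a b h =>
    exact ⟨Unit, Empty, inferInstance, inferInstance, .var (.inl ()), fun _ => a, fun _ => b,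
      Empty.elim, Empty.elim, fun _ => h, fun j => j.elim, rfl, rfl, rfl, rfl⟩
  | col u v h =>
    exact ⟨Empty, Unit, inferInstance, inferInstance, .var (.inr ()), Empty.elim, Empty.elim,
      fun _ => u, fun _ => v, fun j => j.elim, fun _ => h, rfl, rfl, rfl, rfl⟩
  | op f p q r s _ ih =>
    choose X Y hX hY t a b u v hab huv h1 h2 h3 h4 using ih
    have key : ∀ (a : ∀ i, X i → A.carrier) (u : ∀ i, Y i → A.carrier),
        A.evalTrm (Sum.elim (fun x : Σ i, X i => a x.1 x.2) (fun y : Σ i, Y i => u y.1 y.2))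
          (.op f fun i => (t i).subst fun w => .var (Sum.map (Sigma.mk i) (Sigma.mk i) w))
        = A.interp f fun i => A.evalTrm (Sum.elim (a i) (u i)) (t i) := by
      intro a u
      simp only [Alg.evalTrm]
      congr 1
      funext i
      rw [eval_subst]
      congr 1
      funext w
      rcases w with w | w <;> rfl
    refine ⟨Σ i, X i, Σ i, Y i, inferInstance, inferInstance,
      .op f fun i => (t i).subst fun w => .var (Sum.map (Sigma.mk i) (Sigma.mk i) w),
      fun x => a x.1 x.2, fun x => b x.1 x.2, fun x => u x.1 x.2, fun x => v x.1 x.2,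
      fun x => hab _ _, fun x => huv _ _, ?_, ?_, ?_, ?_⟩
    · rw [key]; simp only [h1]
    · rw [key]; simp only [h2]
    · rw [key]; simp only [h3]
    · rw [key]; simp only [h4]

theorem Centralizes.mat {A : Alg σ} {S T δ : Congruence A} (h : Centralizes S T δ)
    {p q r s : A.carrier} (hm : Mat S T p q r s) (hpq : δ.rel p q) : δ.rel r s := by
  obtain ⟨X, Y, hX, hY, t, a, b, u, v, hab, huv, rfl, rfl, rfl, rfl⟩ := hm.exists_term
  obtain ⟨m, ⟨e⟩⟩ := Finite.exists_equiv_fin X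
  obtain ⟨n, ⟨g⟩⟩ := Finite.exists_equiv_fin Y
  have key : ∀ (a : X → A.carrier) (u : Y → A.carrier),
      A.evalTrm (Sum.elim (fun i => a (e.symm i)) (fun j => u (g.symm j)))
        (t.subst fun w => .var (Sum.map e g w)) = A.evalTrm (Sum.elim a u) t := by
    intro a u
    rw [eval_subst]
    congr 1
    funext w
    rcases w with w | w <;> simp [Alg.evalTrm]
  have := h m n (t.subst fun w => .var (Sum.map e g w))
    (fun i => a (e.symm i)) (fun i => b (e.symm i)) (fun i => u (g.symm i))
    (fun i => v (g.symm i)) (fun i => hab _) (fun i => huv _)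
  rw [key, key, key, key] at this
  exact this hpq

theorem centralizes_self {A : Alg σ} (S T : Congruence A) : Centralizes S T T :=
  centralizes_of_mat fun _ _ _ _ h _ => h.cols.2

theorem centralizes_sInf {A : Alg σ} (S T : Congruence A) (D : Set (Congruence A))
    (h : ∀ δ ∈ D, Centralizes S T δ) : Centralizes S T (sInf D) := by
  intro m n t a b u v hab huv hpq c hc
  exact h c hc m n t a b u v hab huv (hpq c hc)

theorem centralizes_commC {A : Alg σ} (S T : Congruence A) :
    Centralizes S T (commC S T) :=
  centralizes_sInf _ _ _ fun _ h => h

theorem centralizes_relCommC {A : Alg σ} (S T ε : Congruence A) :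
    Centralizes S T (relCommC S T ε) :=
  centralizes_sInf _ _ _ fun _ h => h.2

/-- The quotient homomorphism. -/
noncomputable def quotHom (A : Alg σ) (c : Congruence A) : UAHom A (quotAlg A c) where
  toFun := Quotient.mk c.setoid
  map_op f a := by
    refine Quotient.sound (s := c.setoid) (c.compat f _ _ fun i => ?_)
    exact c.iseqv.symm (Quotient.exact (s := c.setoid) (Quotient.out_eq _))

theorem quot_out_rel {A : Alg σ} (c : Congruence A) (a : A.carrier) :
    c.rel (Quotient.mk c.setoid a).out a :=
  Quotient.exact (s := c.setoid) (Quotient.out_eq _)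

/-- The image of a larger congruence in the quotient. -/
noncomputable def quotCong {A : Alg σ} (δ θ : Congruence A) (hle : δ ≤ θ) :
    Congruence (quotAlg A δ) where
  rel p q := θ.rel (Quotient.out (s := δ.setoid) p) (Quotient.out (s := δ.setoid) q)
  iseqv := ⟨fun _ => θ.iseqv.refl _, fun h => θ.iseqv.symm h, fun h k => θ.iseqv.trans h k⟩
  compat f a b hab := by
    refine θ.iseqv.trans (hle _ _ (quot_out_rel δ _)) ?_
    refine θ.iseqv.trans ?_ (θ.iseqv.symm (hle _ _ (quot_out_rel δ _)))
    exact θ.compat f _ _ hab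

theorem weak_rel {V : Variety σ} {d : Trm σ (Fin 3)} (hd : IsWeakDifferenceTrm V d)
    {A : Alg σ} (hA : V.Mem A) {δ θ : Congruence A} (hle : δ ≤ θ)
    (hc : Centralizes θ θ δ) {a b : A.carrier} (hab : θ.rel a b) :
    δ.rel (A.evalTrm ![a, a, b] d) b ∧ δ.rel (A.evalTrm ![a, b, b] d) a := by
  have hQ : V.Mem (quotAlg A δ) :=
    V.closed_hom hA ⟨quotHom A δ, Quotient.mk_surjective⟩
  have hlift : ∀ {W : Type} (t : Trm σ W) (p : W → (quotAlg A δ).carrier),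
      (quotAlg A δ).evalTrm p t =
        (quotHom A δ).toFun (A.evalTrm (fun w => Quotient.out (s := δ.setoid) (p w)) t) := by
    intro W t p
    rw [eval_hom]
    congr 1
    funext w
    exact (Quotient.out_eq _).symm
  have hab' : IsAbelianCong (quotCong δ θ hle) := by
    refine le_bot_iff.mp (sInf_le ?_)
    intro m n t a b u v hab huv hpq
    have hpq := bot_rel hpq
    rw [hlift, hlift] at hpq ⊢
    have := Quotient.exact (s := δ.setoid) hpq
    have e : ∀ (a : Fin m → (quotAlg A δ).carrier) (u : Fin n → (quotAlg A δ).carrier),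
        (fun w => Quotient.out (s := δ.setoid) ((Sum.elim a u : _ → (quotAlg A δ).carrier) w)) =
        Sum.elim (fun i => Quotient.out (s := δ.setoid) (a i))
          (fun i => Quotient.out (s := δ.setoid) (u i)) := by
      intro a u
      funext w
      rcases w with w | w <;> rfl
    have h2 := hc m n t _ _ _ _ hab huv (by rw [← e, ← e]; exact this)
    rw [← e, ← e] at h2
    have h3 := Quotient.sound (s := δ.setoid) h2
    rw [show (quotHom A δ).toFun = Quotient.mk δ.setoid from rfl, h3]
    exact (⊥ : Congruence (quotAlg A δ)).iseqv.refl _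
  have hr : (quotCong δ θ hle).rel (Quotient.mk δ.setoid a) (Quotient.mk δ.setoid b) :=
    θ.iseqv.trans (hle _ _ (quot_out_rel δ _))
      (θ.iseqv.trans hab (θ.iseqv.symm (hle _ _ (quot_out_rel δ _))))
  have := hd _ hQ _ hab' _ _ hr
  have e : ∀ x y z : A.carrier, (quotHom A δ).toFun (A.evalTrm ![x, y, z] d) =
      (quotAlg A δ).evalTrm (V := Fin 3)
        ![Quotient.mk δ.setoid x, Quotient.mk δ.setoid y, Quotient.mk δ.setoid z] d := by
    intro x y z
    rw [eval_hom]
    congr 1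
    funext i
    fin_cases i <;> rfl
  refine ⟨Quotient.exact (s := δ.setoid) ((e _ _ _).trans this.1),
    Quotient.exact (s := δ.setoid) ((e _ _ _).trans this.2)⟩

theorem eval3_compat {A : Alg σ} (c : Congruence A) (d : Trm σ (Fin 3))
    {x y z x' y' z' : A.carrier} (hx : c.rel x x') (hy : c.rel y y') (hz : c.rel z z') :
    c.rel (A.evalTrm ![x, y, z] d) (A.evalTrm ![x', y', z'] d) := by
  apply eval_compat
  intro i
  fin_cases i
  · exact hx
  · exact hy
  · exact hz

theorem Mat.term3 {A : Alg σ} {S T : Congruence A} (d : Trm σ (Fin 3))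
    {p q r s p' q' r' s' p'' q'' r'' s'' : A.carrier}
    (h : Mat S T p q r s) (h' : Mat S T p' q' r' s') (h'' : Mat S T p'' q'' r'' s'') :
    Mat S T (A.evalTrm ![p, p', p''] d) (A.evalTrm ![q, q', q''] d)
      (A.evalTrm ![r, r', r''] d) (A.evalTrm ![s, s', s''] d) := by
  apply Mat.term
  intro i
  fin_cases i
  · exact h
  · exact h'
  · exact h''

/-! ### Forward direction -/

/-- Iterated relations `T ∘ δ ∘ T` starting from `β`. -/
def iterT {A : Alg σ} (β δ : Congruence A) : ℕ → A.carrier → A.carrier → Prop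
  | 0 => β.rel
  | n + 1 => fun a b => ∃ c e, iterT β δ n a c ∧ δ.rel c e ∧ iterT β δ n e b

theorem iterT_refl {A : Alg σ} (β δ : Congruence A) (n : ℕ) (a : A.carrier) :
    iterT β δ n a a := by
  induction n with
  | zero => exact β.iseqv.refl a
  | succ n ih => exact ⟨a, a, ih, δ.iseqv.refl a, ih⟩

theorem iterT_symm {A : Alg σ} (β δ : Congruence A) (n : ℕ) (a b : A.carrier)
    (h : iterT β δ n a b) : iterT β δ n b a := by
  induction n generalizing a b with
  | zero => exact β.iseqv.symm h
  | succ n ih =>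
    obtain ⟨c, e, h1, h2, h3⟩ := h
    exact ⟨e, c, ih _ _ h3, δ.iseqv.symm h2, ih _ _ h1⟩

theorem iterT_compat {A : Alg σ} (β δ : Congruence A) (n : ℕ) (f : σ.ops)
    (a b : Fin (σ.arity f) → A.carrier) (h : ∀ i, iterT β δ n (a i) (b i)) :
    iterT β δ n (A.interp f a) (A.interp f b) := by
  induction n generalizing a b with
  | zero => exact β.compat f _ _ h
  | succ n ih =>
    choose c e h1 h2 h3 using h
    exact ⟨A.interp f c, A.interp f e, ih _ _ h1, δ.compat f _ _ h2, ih _ _ h3⟩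

theorem iterT_term {A : Alg σ} (β δ : Congruence A) (n : ℕ) {W : Type} (t : Trm σ W)
    (a b : W → A.carrier) (h : ∀ i, iterT β δ n (a i) (b i)) :
    iterT β δ n (A.evalTrm a t) (A.evalTrm b t) := by
  induction t with
  | var v => exact h v
  | op f ts ih => exact iterT_compat β δ n f _ _ ih

theorem iterT_mono {A : Alg σ} (β δ : Congruence A) {m n : ℕ} (hmn : m ≤ n)
    (a b : A.carrier) (h : iterT β δ m a b) : iterT β δ n a b := by
  induction hmn with
  | refl => exact h
  | step _ ih => exact ⟨b, b, ih, δ.iseqv.refl _, iterT_refl β δ _ b⟩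

/-- The congruence obtained as the union of the `iterT`. -/
def iterCong {A : Alg σ} (β δ : Congruence A) : Congruence A where
  rel a b := ∃ n, iterT β δ n a b
  iseqv := by
    refine ⟨fun a => ⟨0, iterT_refl β δ 0 a⟩, fun ⟨n, h⟩ => ⟨n, iterT_symm β δ n _ _ h⟩, ?_⟩
    rintro a b c ⟨m, h⟩ ⟨n, k⟩
    exact ⟨max m n + 1, b, b, iterT_mono β δ (le_max_left _ _) _ _ h, δ.iseqv.refl _,
      iterT_mono β δ (le_max_right _ _) _ _ k⟩
  compat f a b h := by
    choose n hn using h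
    exact ⟨Finset.univ.sup n, iterT_compat β δ _ f _ _ fun i =>
      iterT_mono β δ (Finset.le_sup (Finset.mem_univ i)) _ _ (hn i)⟩

theorem sup_le_iterCong {A : Alg σ} (β δ : Congruence A) : β ⊔ δ ≤ iterCong β δ :=
  sup_le (fun _ _ h => ⟨0, h⟩)
    (fun a b h => ⟨1, a, b, β.iseqv.refl _, h, β.iseqv.refl _⟩)

theorem iterT_inter {A : Alg σ} (β δ θ : Congruence A) (d : Trm σ (Fin 3))
    (hle : δ ≤ θ)
    (h1 : ∀ a b : A.carrier, A.evalTrm ![a, a, b] d = b)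
    (h2 : ∀ a b : A.carrier, θ.rel a b → δ.rel (A.evalTrm ![a, b, b] d) a)
    (hβ : ∀ a b, β.rel a b → θ.rel a b → δ.rel a b) (n : ℕ) (a b : A.carrier)
    (h : iterT β δ n a b) (hab : θ.rel a b) : δ.rel a b := by
  induction n generalizing a b with
  | zero => exact hβ a b h hab
  | succ n ih =>
    obtain ⟨c, e, hac, hce, heb⟩ := h
    have k1 : δ.rel (A.evalTrm ![c, e, b] d) b := by
      have := eval3_compat δ d (δ.iseqv.refl c) (δ.iseqv.symm hce) (δ.iseqv.refl b)
      rwa [h1] at this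
    have k2 := h2 a b hab
    have k3 : iterT β δ n (A.evalTrm ![a, b, b] d) (A.evalTrm ![c, e, b] d) := by
      apply iterT_term
      intro i
      fin_cases i
      · exact hac
      · exact iterT_symm β δ n _ _ heb
      · exact iterT_refl β δ n _
    have k4 : θ.rel (A.evalTrm ![a, b, b] d) (A.evalTrm ![c, e, b] d) :=
      θ.iseqv.trans (hle _ _ k2) (θ.iseqv.trans hab (θ.iseqv.symm (hle _ _ k1)))
    exact δ.iseqv.trans (δ.iseqv.symm k2) (δ.iseqv.trans (ih _ _ k3 k4) k1)

theorem forward_pentagon {V : Variety σ} {d : Trm σ (Fin 3)} (hd : IsDifferenceTrm V d)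
    {A : Alg σ} (hA : V.Mem A) {z β δ θ α : Congruence A} (hp : IsPentagon z β δ θ α)
    {x y : Congruence A} (hx : δ ≤ x) (hxy : x < y) (hy : y ≤ θ) :
    relCommC y y x = y := by
  have hw : IsWeakDifferenceTrm V d :=
    fun B hB α hα a b hab => ⟨hd.1 B hB a b, hd.2 B hB α hα a b hab⟩
  obtain ⟨-, hz1, hz2, hj1, hj2⟩ := hp
  have hle : relCommC y y x ≤ y := sInf_le ⟨hxy.le, centralizes_self y y⟩
  have hxw : x ≤ relCommC y y x := le_sInf fun _ h => h.1
  have hc := centralizes_relCommC y y x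
  generalize relCommC y y x = w at *
  refine le_antisymm hle ?_
  intro a b hab
  have hyU : y ≤ iterCong β w := by
    refine le_trans ?_ (sup_le_iterCong β w)
    refine le_trans (hy.trans (le_sup_right : θ ≤ β ⊔ θ)) ?_
    rw [hj2, ← hj1]
    exact sup_le_sup_left (hx.trans hxw) β
  obtain ⟨n, hn⟩ := hyU a b hab
  refine iterT_inter β w y d hle (hd.1 A hA) (fun a b h => (weak_rel hw hA hle hc h).2) ?_ n a b
    hn hab
  intro a b h1 h2
  have : β ⊓ y ≤ w := by
    refine le_trans (inf_le_inf_left β hy) ?_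
    rw [hz1, ← hz2]
    exact inf_le_right.trans (hx.trans hxw)
  refine this a b ?_
  have : ∀ c ∈ ({β, y} : Set (Congruence A)), c.rel a b := by
    rintro c (rfl | rfl)
    · exact h1
    · exact h2
  have hinf : sInf ({β, y} : Set (Congruence A)) ≤ β ⊓ y :=
    le_inf (sInf_le (by simp)) (sInf_le (by simp))
  exact hinf a b this

/-! ### Free algebras -/

/-- The setoid of identities of `V` in variables `X`. -/
def freeSetoid (V : Variety σ) (X : Type) : Setoid (Trm σ X) where
  r s t := ∀ A : Alg σ, V.Mem A → ∀ a : X → A.carrier, A.evalTrm a s = A.evalTrm a t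
  iseqv := ⟨fun _ _ _ _ => rfl, fun h A hA a => (h A hA a).symm,
    fun h k A hA a => (h A hA a).trans (k A hA a)⟩

/-- The free algebra. -/
noncomputable def freeAlg (V : Variety σ) (X : Type) : Alg σ where
  carrier := Quotient (freeSetoid V X)
  interp f a := Quotient.mk (freeSetoid V X) (.op f fun i => (a i).out)

/-- Extension of an assignment to the free algebra. -/
noncomputable def freeHom (V : Variety σ) {X : Type} (A : Alg σ) (hA : V.Mem A)
    (a : X → A.carrier) : UAHom (freeAlg V X) A where
  toFun p := A.evalTrm a (Quotient.out (s := freeSetoid V X) p)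
  map_op f p := by
    have : freeSetoid V X (Quotient.out (s := freeSetoid V X) ((freeAlg V X).interp f p))
        (.op f fun i => Quotient.out (s := freeSetoid V X) (p i)) :=
      Quotient.exact (s := freeSetoid V X) (Quotient.out_eq _)
    exact this A hA a

theorem freeHom_mk (V : Variety σ) {X : Type} (A : Alg σ) (hA : V.Mem A)
    (a : X → A.carrier) (t : Trm σ X) :
    (freeHom V A hA a).toFun (Quotient.mk (freeSetoid V X) t) = A.evalTrm a t := by
  have : freeSetoid V X (Quotient.out (Quotient.mk (freeSetoid V X) t)) t :=
    Quotient.exact (s := freeSetoid V X) (Quotient.out_eq _)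
  exact this A hA a

theorem freeAlg_mem (V : Variety σ) (X : Type) : V.Mem (freeAlg V X) := by
  let I : Type := {p : Trm σ X × Trm σ X // ¬ freeSetoid V X p.1 p.2}
  have hI : ∀ i : I, ∃ A : Alg σ, ∃ _ : V.Mem A, ∃ a : X → A.carrier,
      A.evalTrm a i.1.1 ≠ A.evalTrm a i.1.2 := by
    rintro ⟨p, hp⟩
    by_contra hcon
    push Not at hcon
    exact hp fun A hA a => hcon A hA a
  choose F hF a ha using hI
  refine V.closed_sub (V.closed_prod F hF) ⟨⟨fun p i => (freeHom V (F i) (hF i) (a i)).toFun p,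
    ?_⟩, ?_⟩
  · intro f p
    funext i
    exact (freeHom V (F i) (hF i) (a i)).map_op f p
  · intro p q hpq
    induction p using Quotient.inductionOn with | _ s
    induction q using Quotient.inductionOn with | _ t
    refine Quotient.sound ?_
    by_contra hst
    have := congrFun hpq ⟨(s, t), hst⟩
    simp only at this
    rw [freeHom_mk, freeHom_mk] at this
    exact ha ⟨(s, t), hst⟩ this

theorem algOn_mem (V : Variety σ) (A : Alg σ) (hA : V.Mem A) (α : Congruence A) :
    V.Mem (algOn A α) := by
  refine V.closed_sub (V.closed_prod (fun _ : Bool => A) fun _ => hA)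
    ⟨⟨fun p b => cond b p.1.1 p.1.2, ?_⟩, ?_⟩
  · intro f p
    funext b
    cases b <;> rfl
  · intro p q hpq
    have h1 := congrFun hpq true
    have h2 := congrFun hpq false
    exact Subtype.ext (Prod.ext h1 h2)

/-- First projection of `A(α)`. -/
def fstHom (A : Alg σ) (α : Congruence A) : UAHom (algOn A α) A := ⟨fun p => p.1.1, fun _ _ => rfl⟩

/-- Second projection of `A(α)`. -/
def sndHom (A : Alg σ) (α : Congruence A) : UAHom (algOn A α) A := ⟨fun p => p.1.2, fun _ _ => rfl⟩

/-! ### Backward direction -/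

/-- Abelian intervals with a Maltsev term: `C(η,η;ρ)` goes up. -/
theorem centralizes_up {A : Alg σ} {ρ η X Y : Congruence A} (d : Trm σ (Fin 3))
    (hc : Centralizes η η ρ)
    (hd : ∀ a b, η.rel a b →
      ρ.rel (A.evalTrm ![a, a, b] d) b ∧ ρ.rel (A.evalTrm ![a, b, b] d) a)
    (hX : ρ ≤ X) (hY : Y ≤ η) : Centralizes Y Y X := by
  refine centralizes_of_mat fun p q r s hm hpq => ?_
  have hm := hm.mono hY hY
  have h1 : Mat η η r s r s := Mat.col _ _ hm.cols.2
  have h2 : Mat η η s s q q := Mat.row _ _ (η.iseqv.symm hm.rows.2)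
  have h3 := Mat.term3 d h1 hm.swap h2
  have h4 : ρ.rel (A.evalTrm ![r, p, q] d) (A.evalTrm ![s, q, q] d) := by
    refine hc.mat h3 ?_
    exact ρ.iseqv.trans (hd r s hm.cols.2).1 (ρ.iseqv.symm (hd s s (η.iseqv.refl _)).1)
  have h5 := (hd s q (η.iseqv.symm hm.rows.2)).2
  have h6 := (hd r p (η.iseqv.symm hm.rows.1)).2
  have h7 : X.rel (A.evalTrm ![r, p, p] d) (A.evalTrm ![r, p, q] d) :=
    eval3_compat X d (X.iseqv.refl _) (X.iseqv.refl _) hpq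
  exact X.iseqv.trans (X.iseqv.symm (hX _ _ h6))
    (X.iseqv.trans h7 (X.iseqv.trans (hX _ _ h4) (hX _ _ h5)))

/-- Assignment for unary polynomials. -/
def polyAsg {A : Alg σ} (P : A.carrier) : Option A.carrier → A.carrier
  | none => P
  | some c => c

/-- In an abelian interval `I[ρ,η]` with Maltsev term, the congruence generated by a pair over `ρ`
consists of images of the pair under unary polynomials, modulo `ρ`. -/
def polyCong {A : Alg σ} (ρ η : Congruence A) (d : Trm σ (Fin 3))
    (hle : ρ ≤ η)
    (hd : ∀ a b, η.rel a b →
      ρ.rel (A.evalTrm ![a, a, b] d) b ∧ ρ.rel (A.evalTrm ![a, b, b] d) a)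
    (P Q : A.carrier) (hPQ : η.rel P Q) : Congruence A where
  rel r s := ∃ t : Trm σ (Option A.carrier),
    ρ.rel r (A.evalTrm (polyAsg P) t) ∧ ρ.rel s (A.evalTrm (polyAsg Q) t)
  iseqv := by
    have hη : ∀ t : Trm σ (Option A.carrier),
        η.rel (A.evalTrm (polyAsg P) t) (A.evalTrm (polyAsg Q) t) := by
      intro t
      apply eval_compat
      rintro (_ | c)
      · exact hPQ
      · exact η.iseqv.refl c
    have hη' : ∀ r s (t : Trm σ (Option A.carrier)), ρ.rel r (A.evalTrm (polyAsg P) t) →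
        ρ.rel s (A.evalTrm (polyAsg Q) t) → η.rel r s := fun r s t h1 h2 =>
      η.iseqv.trans (hle _ _ h1) (η.iseqv.trans (hη t) (η.iseqv.symm (hle _ _ h2)))
    have hcomb : ∀ (p : A.carrier) (t1 t2 t3 : Trm σ (Option A.carrier)),
        A.evalTrm (polyAsg p) (d.subst ![t1, t2, t3]) =
        A.evalTrm ![A.evalTrm (polyAsg p) t1, A.evalTrm (polyAsg p) t2,
          A.evalTrm (polyAsg p) t3] d := by
      intro p t1 t2 t3
      rw [eval_subst]
      congr 1
      funext i
      fin_cases i <;> rfl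
    refine ⟨fun a => ⟨.var (some a), ρ.iseqv.refl _, ρ.iseqv.refl _⟩, ?_, ?_⟩
    · rintro r s ⟨t, h1, h2⟩
      have hrs := hη' r s t h1 h2
      refine ⟨d.subst ![.var (some r), t, .var (some s)], ?_, ?_⟩
      · rw [hcomb]
        refine ρ.iseqv.trans (ρ.iseqv.symm (hd r s hrs).1) ?_
        exact eval3_compat ρ d (ρ.iseqv.refl _) h1 (ρ.iseqv.refl _)
      · rw [hcomb]
        refine ρ.iseqv.trans (ρ.iseqv.symm (hd r s hrs).2) ?_
        exact eval3_compat ρ d (ρ.iseqv.refl _) h2 (ρ.iseqv.refl _)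
    · rintro r s w ⟨t, h1, h2⟩ ⟨t', h1', h2'⟩
      have hrs := hη' r s t h1 h2
      have hsw := hη' s w t' h1' h2'
      refine ⟨d.subst ![t, .var (some s), t'], ?_, ?_⟩
      · rw [hcomb]
        refine ρ.iseqv.trans (ρ.iseqv.symm (hd r s hrs).2) ?_
        exact eval3_compat ρ d h1 (ρ.iseqv.refl _) h1'
      · rw [hcomb]
        refine ρ.iseqv.trans (ρ.iseqv.symm (hd s w hsw).1) ?_
        exact eval3_compat ρ d h2 (ρ.iseqv.refl _) h2'
  compat f a b h := by
    choose t h1 h2 using h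
    exact ⟨.op f t, ρ.compat f _ _ h1, ρ.compat f _ _ h2⟩

/-- The key polynomial obtained from the neutrality of critical intervals. -/
theorem exists_poly {V : Variety σ} {d : Trm σ (Fin 3)} (hd : IsWeakDifferenceTrm V d)
    (hN : ∀ A : Alg σ, V.Mem A → ∀ z β δ θ α : Congruence A,
          IsPentagon z β δ θ α →
          ∀ x y : Congruence A, δ ≤ x → x < y → y ≤ θ → relCommC y y x = y)
    {F : Alg σ} (hF : V.Mem F) (θ : Congruence F) (x y : F.carrier) (hxy : θ.rel x y) :
    ∃ t : Trm σ (Option (algOn F θ).carrier),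
      F.evalTrm (fun o => o.elim x fun c => c.1.1) t = y ∧
      (commC θ θ).rel (F.evalTrm (fun o => o.elim x fun c => c.1.2) t) x ∧
      (commC θ θ).rel (F.evalTrm (fun o => o.elim y fun c => c.1.2) t) y := by
  set γ := commC θ θ with hγ
  have hγc : Centralizes θ θ γ := centralizes_commC θ θ
  have hB := algOn_mem V F hF θ
  let η := eta1 F θ
  let β : Congruence (algOn F θ) := comapC (sndHom F θ) γ
  let ρ := η ⊓ β
  have hρ1 : ∀ p q, ρ.rel p q → η.rel p q := (inf_le_left : η ⊓ β ≤ η)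
  have hρ2 : ∀ p q, ρ.rel p q → β.rel p q := (inf_le_right : η ⊓ β ≤ β)
  have hρ3 : ∀ p q, η.rel p q → β.rel p q → ρ.rel p q := by
    intro p q h1 h2
    have : ∀ c ∈ ({η, β} : Set (Congruence (algOn F θ))), c.rel p q := by
      rintro c (rfl | rfl)
      · exact h1
      · exact h2
    have hinf : sInf ({η, β} : Set (Congruence (algOn F θ))) ≤ η ⊓ β :=
      le_inf (sInf_le (by simp)) (sInf_le (by simp))
    exact hinf p q this
  have hle : ρ ≤ η := hρ1
  have hηsnd : ∀ p q, η.rel p q → θ.rel p.1.2 q.1.2 := by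
    intro p q h
    have h : p.1.1 = q.1.1 := h
    refine θ.iseqv.trans (θ.iseqv.symm p.2) ?_
    rw [h]
    exact q.2
  have hmat : ∀ p q r s, Mat η η p q r s → Mat θ θ p.1.2 q.1.2 r.1.2 s.1.2 := by
    intro p q r s h
    induction h with
    | row a b h => exact Mat.row _ _ (hηsnd _ _ h)
    | col u v h => exact Mat.col _ _ (hηsnd _ _ h)
    | op f p q r s _ ih => exact Mat.op f _ _ _ _ ih
  have hc : Centralizes η η ρ := by
    refine centralizes_of_mat fun p q r s hm hpq => hρ3 _ _ hm.cols.2 ?_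
    exact hγc.mat (hmat _ _ _ _ hm) (hρ2 _ _ hpq)
  have hdη : ∀ a b, η.rel a b → ρ.rel ((algOn F θ).evalTrm ![a, a, b] d) b ∧
      ρ.rel ((algOn F θ).evalTrm ![a, b, b] d) a := fun a b h => weak_rel hd hB hle hc h
  let P : (algOn F θ).carrier := ⟨(x, x), θ.iseqv.refl x⟩
  let Q : (algOn F θ).carrier := ⟨(x, y), hxy⟩
  let P' : (algOn F θ).carrier := ⟨(y, x), θ.iseqv.symm hxy⟩
  let Q' : (algOn F θ).carrier := ⟨(y, y), θ.iseqv.refl y⟩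
  have hPQ : η.rel P Q := rfl
  let X := polyCong ρ η d hle hdη P Q hPQ
  have hρX : ρ ≤ X := fun a b h => ⟨.var (some b), h, ρ.iseqv.refl _⟩
  have hXη : X ≤ η := by
    rintro r s ⟨t, h1, h2⟩
    refine η.iseqv.trans (hle _ _ h1) (η.iseqv.trans ?_ (η.iseqv.symm (hle _ _ h2)))
    apply eval_compat
    rintro (_ | c)
    · exact hPQ
    · exact η.iseqv.refl c
  have hXPQ : X.rel P Q := ⟨.var none, ρ.iseqv.refl _, ρ.iseqv.refl _⟩
  have main : X.rel P' Q' := by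
    by_contra hcon
    let Y := X ⊔ cgPair _ P' Q'
    have hcg : (cgPair _ P' Q').rel P' Q' := fun c hc => hc
    have hYη : Y ≤ η := sup_le hXη (sInf_le (show η.rel P' Q' from rfl))
    have hXY : X < Y := by
      refine lt_of_le_of_ne le_sup_left fun h => hcon ?_
      rw [h]
      exact (le_sup_right : cgPair _ P' Q' ≤ Y) _ _ hcg
    have hmeet : ∀ Z, ρ ≤ Z → Z ≤ η → β ⊓ Z = ρ := fun Z h1 h2 =>
      le_antisymm (le_inf (inf_le_right.trans h2) inf_le_left)
        (le_inf inf_le_right h1)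
    have hjoin : β ⊔ Y = β ⊔ X := by
      refine le_antisymm (sup_le le_sup_left (sup_le le_sup_right (sInf_le ?_)))
        (sup_le_sup_left hXY.le β)
      have hb : ∀ p q, β.rel p q → (β ⊔ X).rel p q := (le_sup_left : β ≤ β ⊔ X)
      have hx : ∀ p q, X.rel p q → (β ⊔ X).rel p q := (le_sup_right : X ≤ β ⊔ X)
      refine (β ⊔ X).iseqv.trans (hb P' P ?_) ((β ⊔ X).iseqv.trans (hx P Q hXPQ) (hb Q Q' ?_))
      · exact γ.iseqv.refl x
      · exact γ.iseqv.refl y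
    have hpent : IsPentagon ρ β X Y (β ⊔ X) :=
      ⟨hXY, hmeet Y (hρX.trans hXY.le) hYη, hmeet X hρX hXη, rfl, hjoin⟩
    have h1 := hN _ hB _ _ _ _ _ hpent X Y le_rfl hXY le_rfl
    have h2 : relCommC Y Y X ≤ X := sInf_le ⟨le_rfl, centralizes_up d hc hdη hρX hYη⟩
    rw [h1] at h2
    exact absurd hXY (not_lt_of_ge h2)
  obtain ⟨t, h1, h2⟩ := main
  have e1 : ∀ R : (algOn F θ).carrier, ((algOn F θ).evalTrm (polyAsg R) t).1.1 =
      F.evalTrm (fun o => o.elim R.1.1 fun c => c.1.1) t := by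
    intro R
    refine (eval_hom (fstHom F θ) _ t).trans ?_
    congr 1
    funext o
    cases o <;> rfl
  have e2 : ∀ R : (algOn F θ).carrier, ((algOn F θ).evalTrm (polyAsg R) t).1.2 =
      F.evalTrm (fun o => o.elim R.1.2 fun c => c.1.2) t := by
    intro R
    refine (eval_hom (sndHom F θ) _ t).trans ?_
    congr 1
    funext o
    cases o <;> rfl
  refine ⟨t, ?_, ?_, ?_⟩
  · rw [← e1 P]
    exact (hρ1 _ _ h1).symm
  · rw [← e2 P]
    exact γ.iseqv.symm (hρ2 _ _ h1)
  · rw [← e2 Q]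
    exact γ.iseqv.symm (hρ2 _ _ h2)

theorem backward {V : Variety σ} {d : Trm σ (Fin 3)} (hd : IsWeakDifferenceTrm V d)
    (hN : ∀ A : Alg σ, V.Mem A → ∀ z β δ θ α : Congruence A,
          IsPentagon z β δ θ α →
          ∀ x y : Congruence A, δ ≤ x → x < y → y ≤ θ → relCommC y y x = y) :
    ∃ d : Trm σ (Fin 3), IsDifferenceTrm V d := by
  let F := freeAlg V (Fin 2)
  have hF : V.Mem F := freeAlg_mem V (Fin 2)
  let x : F.carrier := Quotient.mk (freeSetoid V (Fin 2)) (.var 0)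
  let y : F.carrier := Quotient.mk (freeSetoid V (Fin 2)) (.var 1)
  let θ : Congruence F := cgPair F x y
  have hxy : θ.rel x y := fun c hc => hc
  obtain ⟨t, ht1, ht2, ht3⟩ := exists_poly hd hN hF θ x y hxy
  let g : (algOn F θ).carrier → Trm σ (Fin 2) :=
    fun c => Quotient.out (s := freeSetoid V (Fin 2)) c.1.1
  let sub : Fin 3 → Option (algOn F θ).carrier → Trm σ (Fin 3) :=
    fun k o => o.elim (.var k) fun c => (g c).subst ![.var 1, .var 2]
  let D : Trm σ (Fin 3) := d.subst ![t.subst (sub 0), t.subst (sub 1), .var 2]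
  have hsub : ∀ (A : Alg σ) (a : Fin 3 → A.carrier) (k : Fin 3),
      A.evalTrm a (t.subst (sub k)) =
      A.evalTrm (fun o => o.elim (a k) fun c => A.evalTrm ![a 1, a 2] (g c)) t := by
    intro A a k
    rw [eval_subst]
    congr 1
    funext o
    cases o with
    | none => rfl
    | some c =>
      refine (eval_subst _ _ _).trans ?_
      simp only [Option.elim]
      congr 1
      funext i
      fin_cases i <;> rfl
  have hD : ∀ (A : Alg σ) (a : Fin 3 → A.carrier), A.evalTrm a D =
      A.evalTrm ![A.evalTrm (fun o => o.elim (a 0) fun c => A.evalTrm ![a 1, a 2] (g c)) t,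
        A.evalTrm (fun o => o.elim (a 1) fun c => A.evalTrm ![a 1, a 2] (g c)) t, a 2] d := by
    intro A a
    rw [← hsub, ← hsub]
    refine (eval_subst _ _ _).trans ?_
    congr 1
    funext i
    fin_cases i <;> rfl
  have hhom : ∀ (A : Alg σ) (hA : V.Mem A) (a b : A.carrier)
      (u : F.carrier) (w : (algOn F θ).carrier → F.carrier),
      (freeHom V A hA ![a, b]).toFun (F.evalTrm (fun o => o.elim u w) t) =
      A.evalTrm (fun o => o.elim ((freeHom V A hA ![a, b]).toFun u)
        fun c => (freeHom V A hA ![a, b]).toFun (w c)) t := by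
    intro A hA a b u w
    refine (eval_hom _ _ t).trans ?_
    congr 1
    funext o
    cases o <;> rfl
  have hx : ∀ (A : Alg σ) (hA : V.Mem A) (a b : A.carrier),
      (freeHom V A hA ![a, b]).toFun x = a := fun A hA a b => freeHom_mk V A hA _ _
  have hy : ∀ (A : Alg σ) (hA : V.Mem A) (a b : A.carrier),
      (freeHom V A hA ![a, b]).toFun y = b := fun A hA a b => freeHom_mk V A hA _ _
  refine ⟨D, ?_, ?_⟩
  · intro A hA a b
    rw [hD]
    have h := congrArg (freeHom V A hA ![a, b]).toFun ht1
    rw [hhom, hx, hy] at h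
    have h' : A.evalTrm (fun o => o.elim a fun c => A.evalTrm ![a, b] (g c)) t = b := h
    have hbot : IsAbelianCong (⊥ : Congruence A) :=
      le_bot_iff.mp (sInf_le (centralizes_self ⊥ ⊥))
    have hid := (hd A hA ⊥ hbot b b ((⊥ : Congruence A).iseqv.refl b)).1
    simp only [Matrix.cons_val_zero, Matrix.cons_val_one, Matrix.cons_val]
    rw [h']
    exact hid
  · intro A hA α hα a b hab
    have hαc : Centralizes α α ⊥ := by
      have := centralizes_commC α α
      rwa [show commC α α = ⊥ from hα] at this
    have hdα := hd A hA α hα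
    let ψ := freeHom V A hA ![a, b]
    have hθψ : θ ≤ comapC ψ α := by
      refine sInf_le ?_
      change α.rel (ψ.toFun x) (ψ.toFun y)
      rw [hx, hy]
      exact hab
    have hγψ : commC θ θ ≤ comapC ψ ⊥ := by
      refine sInf_le (centralizes_of_mat fun p q r s hm hpq => ?_)
      have hm' : Mat α α (ψ.toFun p) (ψ.toFun q) (ψ.toFun r) (ψ.toFun s) := by
        clear hpq
        induction hm with
        | row a b h => exact Mat.row _ _ (hθψ _ _ h)
        | col u v h => exact Mat.col _ _ (hθψ _ _ h)
        | op f p q r s _ ih =>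
          rw [ψ.map_op, ψ.map_op, ψ.map_op, ψ.map_op]
          exact Mat.op f _ _ _ _ ih
      exact hαc.mat hm' hpq
    have k2 := bot_rel (hγψ _ _ ht2)
    have k3 := bot_rel (hγψ _ _ ht3)
    rw [hhom, hx] at k2
    rw [hhom, hy] at k3
    rw [hD]
    simp only [Matrix.cons_val_zero, Matrix.cons_val_one, Matrix.cons_val]
    let h : (algOn F θ).carrier → A.carrier := fun c => ψ.toFun c.1.2
    let h' : (algOn F θ).carrier → A.carrier := fun c => A.evalTrm ![b, b] (g c)
    have k2 : A.evalTrm (fun o => o.elim a h) t = a := k2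
    have k3 : A.evalTrm (fun o => o.elim b h) t = b := k3
    change A.evalTrm ![A.evalTrm (fun o => o.elim a h') t,
      A.evalTrm (fun o => o.elim b h') t, b] d = a
    have hh : ∀ c, α.rel (h c) (h' c) := by
      intro c
      have h1 : α.rel (ψ.toFun c.1.1) (ψ.toFun c.1.2) := hθψ _ _ c.2
      have h2 : α.rel (ψ.toFun c.1.1) (A.evalTrm ![b, b] (g c)) := by
        refine eval_compat α (g c) ![a, b] ![b, b] ?_
        intro i
        fin_cases i
        · exact hab
        · exact α.iseqv.refl b
      exact α.iseqv.trans (α.iseqv.symm h1) h2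
    have m1 : Mat α α (A.evalTrm (fun o => o.elim b h) t) (A.evalTrm (fun o => o.elim b h') t)
        (A.evalTrm (fun o => o.elim a h) t) (A.evalTrm (fun o => o.elim a h') t) := by
      apply Mat.term
      rintro (_ | c)
      · exact Mat.row _ _ (α.iseqv.symm hab)
      · exact Mat.col _ _ (hh c)
    have hs := m1.cols.1
    have m2 : Mat α α (A.evalTrm (fun o => o.elim b h) t) (A.evalTrm (fun o => o.elim b h') t)
        (A.evalTrm (fun o => o.elim b h) t) (A.evalTrm (fun o => o.elim b h') t) :=
      Mat.col _ _ hs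
    have m3 : Mat α α b b b b := Mat.row _ _ (α.iseqv.refl b)
    have m4 := Mat.term3 d m1 m2 m3
    rw [k2, k3] at m4
    rw [k3] at hs
    have hpq : (⊥ : Congruence A).rel (A.evalTrm ![b, b, b] d)
        (A.evalTrm ![A.evalTrm (fun o => o.elim b h') t,
          A.evalTrm (fun o => o.elim b h') t, b] d) := by
      rw [(hdα b b (α.iseqv.refl b)).1, (hdα _ b (α.iseqv.symm hs)).1]
      exact (⊥ : Congruence A).iseqv.refl b
    have fin := bot_rel (hαc.mat m4 hpq)
    rw [(hdα a b hab).2] at fin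
    exact fin.symm

end Helpers

/-- A variety has a difference term if and only if it has a weak difference
term and the critical interval `I[δ,θ]` of every pentagon in a congruence
lattice of a member is neutral (`[y,y]_x = y` whenever `δ ≤ x < y ≤ θ`). -/
theorem difference_term_iff_weak_and_neutral_pentagons {σ : Sig}
    (V : Variety σ) :
    (∃ d : Trm σ (Fin 3), IsDifferenceTrm V d) ↔
      ((∃ d : Trm σ (Fin 3), IsWeakDifferenceTrm V d) ∧
        ∀ A : Alg σ, V.Mem A → ∀ z β δ θ α : Congruence A,
          IsPentagon z β δ θ α →
          ∀ x y : Congruence A, δ ≤ x → x < y → y ≤ θ →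
            relCommC y y x = y) := by
  constructor
  · rintro ⟨d, hd⟩
    exact ⟨⟨d, fun B hB α hα a b hab => ⟨hd.1 B hB a b, hd.2 B hB α hα a b hab⟩⟩,
      fun A hA z β δ θ α hp x y hx hxy hy => forward_pentagon hd hA hp hx hxy hy⟩
  · rintro ⟨⟨d, hd⟩, hN⟩
    exact backward hd hN
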